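/- arXiv:1312.7305 — 3 statements merged into one kernel-verified Lean document; each statement's English description precedes it below -/
import Mathlib

section
/- For every real ε ∈ [0,1) there exists a topological embedding f : 2^ℕ → ℝ whose range is a compact subset of [0,1] such that λ(f(A)) = ε·μ(A) for every closed set A ⊆ 2^ℕ, where λ denotes Lebesgue measure on ℝ. (The range of f is the Smith–Volterra–Cantor set C_ε, of Lebesgue measure ε.) -/
open MeasureTheory ENNReal

/-- The cylinder of all binary sequences in Cantor space having the finite binary word `w`
as a prefix. -/
def cantorCyl (w : List Bool) : Set (ℕ → Bool) :=
  {p | ∀ i : Fin w.length, p i = w.get i}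

open Set Filter Topology

/-- The point of `[0,1]` whose binary digits are given by `p`. -/
noncomputable def binaryPoint (p : ℕ → Bool) : ℝ :=
  Real.ofDigits (b := 2) fun i => bif p i then 1 else 0

/-- The point of the ternary Cantor set whose ternary digits are `0` and `2`, as given by `p`. -/
noncomputable def ternaryPoint (p : ℕ → Bool) : ℝ :=
  Real.ofDigits (b := 3) fun i => bif p i then 2 else 0

/-- A combination of the binary and the ternary reading of a binary sequence. For positive
`α` and `β` the range is a fat Cantor set of measure `α` inside `[0, α + β]`. -/
noncomputable def fatCantorMap (α β : ℝ) (p : ℕ → Bool) : ℝ :=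
  α * binaryPoint p + β * ternaryPoint p

theorem binaryPoint_mem_Icc (p : ℕ → Bool) : binaryPoint p ∈ Icc (0 : ℝ) 1 :=
  ⟨Real.ofDigits_nonneg _, Real.ofDigits_le_one _⟩

theorem ternaryPoint_mem_Icc (p : ℕ → Bool) : ternaryPoint p ∈ Icc (0 : ℝ) 1 :=
  ⟨Real.ofDigits_nonneg _, Real.ofDigits_le_one _⟩

theorem binaryPoint_eq (p : ℕ → Bool) :
    binaryPoint p = (bif p 0 then 1 / 2 else 0) + binaryPoint (fun i => p (i + 1)) / 2 := by
  rw [binaryPoint, Real.ofDigits_eq_sum_add_ofDigits _ 1]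
  cases h : p 0 <;> simp [Real.ofDigitsTerm, binaryPoint, h] <;> ring

theorem ternaryPoint_eq (p : ℕ → Bool) :
    ternaryPoint p = (bif p 0 then 2 / 3 else 0) + ternaryPoint (fun i => p (i + 1)) / 3 := by
  rw [ternaryPoint, Real.ofDigits_eq_sum_add_ofDigits _ 1]
  cases h : p 0 <;> simp [Real.ofDigitsTerm, ternaryPoint, h] <;> ring

theorem continuous_binaryPoint : Continuous binaryPoint :=
  Real.continuous_ofDigits.comp <| continuous_pi fun i =>
    (continuous_of_discreteTopology (f := fun x : Bool => (bif x then 1 else 0 : Fin 2))).comp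
      (continuous_apply i)

theorem continuous_ternaryPoint : Continuous ternaryPoint :=
  Real.continuous_ofDigits.comp <| continuous_pi fun i =>
    (continuous_of_discreteTopology (f := fun x : Bool => (bif x then 2 else 0 : Fin 3))).comp
      (continuous_apply i)

theorem exists_binaryPoint_eq {y : ℝ} (hy : y ∈ Icc (0 : ℝ) 1) : ∃ p, binaryPoint p = y := by
  obtain ⟨d, -, rfl⟩ := Real.ofDigits_SurjOn (b := 2) one_lt_two hy
  refine ⟨fun i => d i == 1, congrArg Real.ofDigits (funext fun i => ?_)⟩
  change (bif d i == 1 then 1 else 0) = d i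
  generalize d i = x
  fin_cases x <;> rfl

/-- Both readings are monotone for the lexicographic order, the ternary one strictly. -/
theorem binaryPoint_le_and_ternaryPoint_lt (n : ℕ) (p q : ℕ → Bool) (h : ∀ i < n, p i = q i)
    (hp : p n = false) (hq : q n = true) :
    binaryPoint p ≤ binaryPoint q ∧ ternaryPoint p < ternaryPoint q := by
  induction n generalizing p q with
  | zero =>
    rw [binaryPoint_eq p, binaryPoint_eq q, ternaryPoint_eq p, ternaryPoint_eq q, hp, hq]
    have h₁ := (binaryPoint_mem_Icc fun i => p (i + 1)).2
    have h₂ := (binaryPoint_mem_Icc fun i => q (i + 1)).1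
    have h₃ := (ternaryPoint_mem_Icc fun i => p (i + 1)).2
    have h₄ := (ternaryPoint_mem_Icc fun i => q (i + 1)).1
    simp only [cond_true, cond_false]
    constructor <;> linarith
  | succ n ih =>
    obtain ⟨h₁, h₂⟩ := ih (fun i => p (i + 1)) (fun i => q (i + 1))
      (fun i hi => h _ (Nat.succ_lt_succ hi)) hp hq
    rw [binaryPoint_eq p, binaryPoint_eq q, ternaryPoint_eq p, ternaryPoint_eq q,
      h 0 n.succ_pos]
    constructor <;> linarith

theorem lexicographic_cases {p q : ℕ → Bool} (hpq : p ≠ q) :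
    (binaryPoint p ≤ binaryPoint q ∧ ternaryPoint p < ternaryPoint q) ∨
      (binaryPoint q ≤ binaryPoint p ∧ ternaryPoint q < ternaryPoint p) := by
  have hne := PiNat.apply_firstDiff_ne hpq
  have heq : ∀ i < PiNat.firstDiff p q, p i = q i := fun i => PiNat.apply_eq_of_lt_firstDiff
  cases hp : p (PiNat.firstDiff p q) <;> cases hq : q (PiNat.firstDiff p q)
  · exact absurd (hp.trans hq.symm) hne
  · exact .inl (binaryPoint_le_and_ternaryPoint_lt _ _ _ heq hp hq)
  · exact .inr (binaryPoint_le_and_ternaryPoint_lt _ _ _ (fun i hi => (heq i hi).symm) hq hp)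
  · exact absurd (hp.trans hq.symm) hne

theorem continuous_fatCantorMap (α β : ℝ) : Continuous (fatCantorMap α β) :=
  (continuous_binaryPoint.const_mul α).add (continuous_ternaryPoint.const_mul β)

theorem fatCantorMap_injective {α β : ℝ} (hα : 0 ≤ α) (hβ : 0 < β) :
    Function.Injective (fatCantorMap α β) := by
  intro p q hpq
  by_contra hne
  simp only [fatCantorMap] at hpq
  rcases lexicographic_cases hne with ⟨h₁, h₂⟩ | ⟨h₁, h₂⟩ <;>
    linarith [mul_le_mul_of_nonneg_left h₁ hα, mul_lt_mul_of_pos_left h₂ hβ]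

theorem fatCantorMap_mem_Icc {α β : ℝ} (hα : 0 ≤ α) (hβ : 0 ≤ β) (p : ℕ → Bool) :
    fatCantorMap α β p ∈ Icc 0 (α + β) := by
  obtain ⟨h₁, h₂⟩ := binaryPoint_mem_Icc p
  obtain ⟨h₃, h₄⟩ := ternaryPoint_mem_Icc p
  exact ⟨by unfold fatCantorMap; positivity,
    add_le_add (mul_le_of_le_one_right hα h₂) (mul_le_of_le_one_right hβ h₄)⟩

theorem mul_abs_binaryPoint_sub_le (α : ℝ) {β : ℝ} (hβ : 0 ≤ β) (p q : ℕ → Bool) :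
    α * |binaryPoint p - binaryPoint q| ≤ |fatCantorMap α β p - fatCantorMap α β q| := by
  rcases eq_or_ne p q with rfl | hne
  · simp
  simp only [fatCantorMap]
  rcases lexicographic_cases hne with ⟨h₁, h₂⟩ | ⟨h₁, h₂⟩
  · rw [abs_of_nonpos (sub_nonpos.2 h₁)]
    refine le_trans ?_ (neg_le_abs _)
    linarith [mul_le_mul_of_nonneg_left h₂.le hβ]
  · rw [abs_of_nonneg (sub_nonneg.2 h₁)]
    refine le_trans ?_ (le_abs_self _)
    linarith [mul_le_mul_of_nonneg_left h₂.le hβ]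

theorem fatCantorMap_eq (α β : ℝ) (p : ℕ → Bool) :
    fatCantorMap α β p = (bif p 0 then α / 2 + β * (2 / 3) else 0) +
      fatCantorMap (α / 2) (β / 3) (fun i => p (i + 1)) := by
  rw [fatCantorMap, binaryPoint_eq, ternaryPoint_eq, fatCantorMap]
  cases p 0 <;> simp only [cond_true, cond_false] <;> ring

theorem cantorCyl_nil : cantorCyl [] = univ :=
  eq_univ_of_forall fun _ i => i.elim0

theorem mem_cantorCyl_cons {x : Bool} {w : List Bool} {p : ℕ → Bool} :
    p ∈ cantorCyl (x :: w) ↔ p 0 = x ∧ (fun i => p (i + 1)) ∈ cantorCyl w := by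
  simp [cantorCyl, Fin.forall_fin_succ]

theorem fatCantorMap_image_cantorCyl_cons (α β : ℝ) (x : Bool) (w : List Bool) :
    fatCantorMap α β '' cantorCyl (x :: w) =
      (fun t => (bif x then α / 2 + β * (2 / 3) else 0) + t) ''
        (fatCantorMap (α / 2) (β / 3) '' cantorCyl w) := by
  ext y
  constructor
  · rintro ⟨p, hp, rfl⟩
    obtain ⟨rfl, hp'⟩ := mem_cantorCyl_cons.1 hp
    exact ⟨_, ⟨_, hp', rfl⟩, (fatCantorMap_eq α β p).symm⟩
  · rintro ⟨_, ⟨p, hp, rfl⟩, rfl⟩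
    exact ⟨fun n => Nat.casesOn n x p, mem_cantorCyl_cons.2 ⟨rfl, hp⟩, fatCantorMap_eq α β _⟩

theorem volume_fatCantorMap_image_cantorCyl_cons (α β : ℝ) (x : Bool) (w : List Bool) :
    volume (fatCantorMap α β '' cantorCyl (x :: w)) =
      volume (fatCantorMap (α / 2) (β / 3) '' cantorCyl w) := by
  rw [fatCantorMap_image_cantorCyl_cons, image_add_left, measure_preimage_add]

theorem volume_range_fatCantorMap_le_two_mul (α β : ℝ) :
    volume (range (fatCantorMap α β)) ≤ 2 * volume (range (fatCantorMap (α / 2) (β / 3))) := by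
  have hcover : range (fatCantorMap α β) ⊆
      fatCantorMap α β '' cantorCyl [false] ∪ fatCantorMap α β '' cantorCyl [true] := by
    rintro _ ⟨p, rfl⟩
    cases h : p 0
    · exact .inl ⟨p, mem_cantorCyl_cons.2 ⟨h, cantorCyl_nil ▸ mem_univ _⟩, rfl⟩
    · exact .inr ⟨p, mem_cantorCyl_cons.2 ⟨h, cantorCyl_nil ▸ mem_univ _⟩, rfl⟩
  refine (measure_mono hcover).trans ((measure_union_le _ _).trans_eq ?_)
  simp only [volume_fatCantorMap_image_cantorCyl_cons, cantorCyl_nil, image_univ, two_mul]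

theorem volume_range_fatCantorMap_le_of_nat (n : ℕ) {α β : ℝ} (hα : 0 ≤ α) (hβ : 0 ≤ β) :
    volume (range (fatCantorMap α β)) ≤ ENNReal.ofReal (α + (2 / 3) ^ n * β) := by
  induction n generalizing α β with
  | zero =>
    refine (measure_mono (range_subset_iff.2 (fatCantorMap_mem_Icc hα hβ))).trans_eq ?_
    simp
  | succ n ih =>
    refine (volume_range_fatCantorMap_le_two_mul α β).trans ?_
    refine (mul_le_mul_right (ih (by positivity) (by positivity)) 2).trans_eq ?_
    rw [show (2 : ℝ≥0∞) = ENNReal.ofReal 2 by simp, ← ENNReal.ofReal_mul zero_le_two]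
    congr 1
    ring

theorem volume_range_fatCantorMap_le {α β : ℝ} (hα : 0 ≤ α) (hβ : 0 ≤ β) :
    volume (range (fatCantorMap α β)) ≤ ENNReal.ofReal α := by
  have hlim : Tendsto (fun n : ℕ => α + (2 / 3 : ℝ) ^ n * β) atTop (𝓝 α) := by
    simpa using ((tendsto_pow_atTop_nhds_zero_of_lt_one (r := (2 / 3 : ℝ)) (by norm_num)
      (by norm_num)).mul_const β).const_add α
  exact ge_of_tendsto' (ENNReal.tendsto_ofReal hlim) fun n =>
    volume_range_fatCantorMap_le_of_nat n hα hβ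

theorem le_volume_range_fatCantorMap {α β : ℝ} (hα : 0 ≤ α) (hβ : 0 ≤ β) :
    ENNReal.ofReal α ≤ volume (range (fatCantorMap α β)) := by
  rcases hα.eq_or_lt with rfl | hα'
  · simp
  let g : ℝ → ℝ := fun x => binaryPoint (Function.invFun (fatCantorMap α β) x)
  have hinv : ∀ p, fatCantorMap α β (Function.invFun (fatCantorMap α β) (fatCantorMap α β p)) =
      fatCantorMap α β p := fun p => Function.invFun_eq ⟨p, rfl⟩
  have hgp : ∀ p, g (fatCantorMap α β p) = binaryPoint p := by
    intro p
    have h := mul_abs_binaryPoint_sub_le α hβ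
      (Function.invFun (fatCantorMap α β) (fatCantorMap α β p)) p
    rw [hinv, sub_self, abs_zero] at h
    exact sub_eq_zero.1 (abs_nonpos_iff.1 (nonpos_of_mul_nonpos_right h hα'))
  have hlip : LipschitzOnWith (Real.toNNReal α⁻¹) g (range (fatCantorMap α β)) := by
    refine LipschitzOnWith.of_dist_le_mul ?_
    rintro _ ⟨p, rfl⟩ _ ⟨q, rfl⟩
    rw [hgp, hgp, Real.coe_toNNReal _ (inv_nonneg.2 hα), Real.dist_eq, Real.dist_eq,
      le_inv_mul_iff₀ hα']
    exact mul_abs_binaryPoint_sub_le α hβ p q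
  have hsub : Icc (0 : ℝ) 1 ⊆ g '' range (fatCantorMap α β) := by
    intro y hy
    obtain ⟨p, rfl⟩ := exists_binaryPoint_eq hy
    exact ⟨_, ⟨p, rfl⟩, hgp p⟩
  have hle := hlip.hausdorffMeasure_image_le zero_le_one
  rw [hausdorffMeasure_real, ENNReal.rpow_one] at hle
  have hone : 1 ≤ ENNReal.ofReal α⁻¹ * volume (range (fatCantorMap α β)) := by
    simpa [ENNReal.ofReal] using (measure_mono hsub).trans hle
  calc ENNReal.ofReal α = ENNReal.ofReal α * 1 := (mul_one _).symm
    _ ≤ ENNReal.ofReal α * (ENNReal.ofReal α⁻¹ * volume (range (fatCantorMap α β))) := by gcongr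
    _ = volume (range (fatCantorMap α β)) := by
      rw [← mul_assoc, ← ENNReal.ofReal_mul hα, mul_inv_cancel₀ hα'.ne', ENNReal.ofReal_one,
        one_mul]

theorem volume_fatCantorMap_image_cantorCyl {α β : ℝ} (hα : 0 ≤ α) (hβ : 0 ≤ β)
    (w : List Bool) :
    volume (fatCantorMap α β '' cantorCyl w) = ENNReal.ofReal α * 2⁻¹ ^ w.length := by
  induction w generalizing α β with
  | nil =>
    rw [cantorCyl_nil, image_univ, List.length_nil, pow_zero, mul_one]
    exact (volume_range_fatCantorMap_le hα hβ).antisymm (le_volume_range_fatCantorMap hα hβ)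
  | cons x w ih =>
    rw [volume_fatCantorMap_image_cantorCyl_cons, ih (by positivity) (by positivity),
      List.length_cons, pow_succ', ← mul_assoc, ENNReal.ofReal_div_of_pos two_pos,
      ENNReal.ofReal_ofNat, div_eq_mul_inv]

theorem cylinder_eq_cantorCyl (x : ℕ → Bool) (n : ℕ) :
    PiNat.cylinder x n = cantorCyl (List.ofFn fun i : Fin n => x i) := by
  ext p
  simp only [PiNat.mem_cylinder_iff, cantorCyl, mem_ofPred_eq]
  constructor
  · intro h i
    simpa using h i (by simpa using i.2)
  · intro h i hi
    simpa using h ⟨i, by simpa using hi⟩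

theorem isPiSystem_cylinder :
    IsPiSystem {s : Set (ℕ → Bool) | ∃ (x : ℕ → Bool) (n : ℕ), s = PiNat.cylinder x n} := by
  rintro _ ⟨x, m, rfl⟩ _ ⟨y, n, rfl⟩ ⟨z, hx, hy⟩
  rw [← PiNat.mem_cylinder_iff_eq.1 hx, ← PiNat.mem_cylinder_iff_eq.1 hy]
  rcases le_total m n with h | h
  · exact ⟨z, n, inter_eq_right.2 (PiNat.cylinder_anti z h)⟩
  · exact ⟨z, m, inter_eq_left.2 (PiNat.cylinder_anti z h)⟩

/-- Finite measures on Cantor space are determined by their values on cylinders. -/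
theorem measure_ext_of_cantorCyl {μ ν : Measure (ℕ → Bool)} [IsFiniteMeasure μ]
    (h : ∀ w, μ (cantorCyl w) = ν (cantorCyl w)) : μ = ν := by
  refine ext_of_generate_finite _ ?_ isPiSystem_cylinder ?_ ?_
  · rw [BorelSpace.measurable_eq (α := ℕ → Bool)]
    exact (PiNat.isTopologicalBasis_cylinders fun _ : ℕ => Bool).borel_eq_generateFrom
  · rintro _ ⟨x, n, rfl⟩
    rw [cylinder_eq_cantorCyl, h]
  · rw [← cantorCyl_nil, h]

/-- Smith–Volterra–Cantor set construction: for every real `ε ∈ [0,1)` there is a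
topological embedding `f : 2^ℕ → ℝ` with compact range contained in `[0,1]` such that
`λ(f(A)) = ε·μ(A)` for every closed `A ⊆ 2^ℕ`, where `μ` is the fair-coin measure
(characterized by `μ([w]) = 2^{-|w|}` on cylinders) and `λ` is Lebesgue measure. -/
theorem stmt5 (μ : Measure (ℕ → Bool))
    (hμ : ∀ w : List Bool, μ (cantorCyl w) = (2 : ℝ≥0∞)⁻¹ ^ w.length)
    (ε : ℝ) (hε : ε ∈ Set.Ico (0 : ℝ) 1) :
    ∃ f : (ℕ → Bool) → ℝ, Topology.IsEmbedding f ∧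
      IsCompact (Set.range f) ∧ Set.range f ⊆ Set.Icc 0 1 ∧
      ∀ A : Set (ℕ → Bool), IsClosed A →
        volume (f '' A) = ENNReal.ofReal ε * μ A := by
  obtain ⟨hε₀, hε₁⟩ := hε
  have hβ : 0 < 1 - ε := sub_pos.2 hε₁
  have hcont := continuous_fatCantorMap ε (1 - ε)
  have hemb := hcont.isClosedEmbedding (fatCantorMap_injective hε₀ hβ)
  refine ⟨fatCantorMap ε (1 - ε), hemb.isEmbedding, isCompact_range hcont,
    range_subset_iff.2 fun p => by simpa using fatCantorMap_mem_Icc hε₀ hβ.le p, ?_⟩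
  have : IsFiniteMeasure μ := ⟨by
    rw [← cantorCyl_nil, hμ]
    simp⟩
  have : IsFiniteMeasure (ENNReal.ofReal ε • μ) := μ.smul_finite ENNReal.ofReal_ne_top
  have hmeas : ENNReal.ofReal ε • μ = volume.comap (fatCantorMap ε (1 - ε)) :=
    measure_ext_of_cantorCyl fun w => by
      rw [hemb.measurableEmbedding.comap_apply, volume_fatCantorMap_image_cantorCyl hε₀ hβ.le,
        Measure.smul_apply, hμ, smul_eq_mul]
  intro A _
  rw [← hemb.measurableEmbedding.comap_apply, ← hmeas, Measure.smul_apply, smul_eq_mul]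
end

section
/- Let I ⊆ [0,1] be a nonempty interval (order-connected subset of [0,1]). Then I is closed under multiplication (i.e. x,y ∈ I implies x·y ∈ I) if and only if one of the following holds: (1) I = {1}; (2) 0 ∈ I; (3) there exists b ∈ (0,1] such that I = (0,b) or I = (0,b]. -/
/-- A nonempty interval (order-connected set) `I ⊆ [0,1]` is closed under multiplication
if and only if `I = {1}`, or `0 ∈ I`, or `I = (0,b)` or `I = (0,b]` for some
`b ∈ (0,1]`. -/
theorem stmt12 (I : Set ℝ) (hsub : I ⊆ Set.Icc 0 1) (hne : I.Nonempty)
    (hOrd : I.OrdConnected) :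
    (∀ x ∈ I, ∀ y ∈ I, x * y ∈ I) ↔
      (I = {1} ∨ (0 : ℝ) ∈ I ∨
        ∃ b ∈ Set.Ioc (0 : ℝ) 1, I = Set.Ioo 0 b ∨ I = Set.Ioc 0 b) := by
  constructor
  · intro hmul
    by_cases h1 : I = {1}
    · exact Or.inl h1
    by_cases h0 : (0 : ℝ) ∈ I
    · exact Or.inr (Or.inl h0)
    refine Or.inr (Or.inr ?_)
    have hpos : ∀ y ∈ I, 0 < y := fun y hy =>
      lt_of_le_of_ne (hsub hy).1 fun h => h0 (h ▸ hy)
    obtain ⟨x, hx, hx1⟩ : ∃ x ∈ I, x ≠ 1 := by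
      by_contra! h
      exact h1 (Set.eq_singleton_iff_nonempty_unique_mem.2 ⟨hne, h⟩)
    have hxlt : x < 1 := lt_of_le_of_ne (hsub hx).2 hx1
    have hpow : ∀ n : ℕ, x ^ (n + 1) ∈ I := by
      intro n
      induction n with
      | zero => simpa using hx
      | succ n ih => exact pow_succ x (n + 1) ▸ hmul _ ih _ hx
    have hbdd : BddAbove I := ⟨1, fun y hy => (hsub hy).2⟩
    have hlt : ∀ y, 0 < y → y < sSup I → y ∈ I := by
      intro y hy0 hyb
      obtain ⟨z, hz, hyz⟩ := exists_lt_of_lt_csSup hne hyb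
      obtain ⟨n, hn⟩ := exists_pow_lt_of_lt_one hy0 hxlt
      have hle : x ^ (n + 1) ≤ y :=
        (pow_le_pow_of_le_one (hpos x hx).le hxlt.le n.le_succ).trans hn.le
      exact hOrd.out (hpow n) hz ⟨hle, hyz.le⟩
    refine ⟨sSup I, ⟨(hpos x hx).trans_le (le_csSup hbdd hx),
      csSup_le hne fun y hy => (hsub hy).2⟩, ?_⟩
    by_cases hb : sSup I ∈ I
    · right
      ext y
      refine ⟨fun hy => ⟨hpos y hy, le_csSup hbdd hy⟩, fun hy => ?_⟩
      rcases hy.2.lt_or_eq with h | h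
      · exact hlt y hy.1 h
      · exact h ▸ hb
    · left
      ext y
      exact ⟨fun hy => ⟨hpos y hy, lt_of_le_of_ne (le_csSup hbdd hy) fun h => hb (h ▸ hy)⟩,
        fun hy => hlt y hy.1 hy.2⟩
  · intro h x hx y hy
    have hle : x * y ≤ y := mul_le_of_le_one_left (hsub hy).1 (hsub hx).2
    rcases h with rfl | h0 | ⟨b, -, rfl | rfl⟩
    · simp_all
    · exact hOrd.out h0 hy ⟨mul_nonneg (hsub hx).1 (hsub hy).1, hle⟩
    · exact ⟨mul_pos hx.1 hy.1, hle.trans_lt hy.2⟩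
    · exact ⟨mul_pos hx.1 hy.1, hle.trans hy.2⟩
end

section
/- For every a ∈ [0,1], consider the 2×2 bi-matrix game (A,B) with A = [[1,−1],[−1,a]] and B = [[−1,1],[1,−1]]. Then (x,y) ∈ S² × S² is a Nash equilibrium of (A,B) if and only if x = (1/2, 1/2) and y = ((1+a)/(3+a), 2/(3+a)); in particular this game has a unique Nash equilibrium. -/
open Matrix

/-- For `a ∈ [0,1]`, the 2×2 bi-matrix game with payoff matrices
`A = [[1,-1],[-1,a]]` and `B = [[-1,1],[1,-1]]` has the unique Nash equilibrium
`x = (1/2, 1/2)`, `y = ((1+a)/(3+a), 2/(3+a))`: a pair of mixed strategies `(x,y)` is a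
Nash equilibrium of this game if and only if it equals this pair. -/
theorem stmt16 (a : ℝ) (ha : a ∈ Set.Icc (0 : ℝ) 1)
    (x y : Fin 2 → ℝ)
    (hx : x ∈ stdSimplex ℝ (Fin 2)) (hy : y ∈ stdSimplex ℝ (Fin 2)) :
    ((∀ w ∈ stdSimplex ℝ (Fin 2),
        w ⬝ᵥ (!![1, -1; -1, a]).mulVec y ≤ x ⬝ᵥ (!![1, -1; -1, a]).mulVec y) ∧
      (∀ z ∈ stdSimplex ℝ (Fin 2),
        x ⬝ᵥ (!![-1, 1; 1, -1]).mulVec z ≤ x ⬝ᵥ (!![-1, 1; 1, -1]).mulVec y)) ↔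
      (x = ![1 / 2, 1 / 2] ∧ y = ![(1 + a) / (3 + a), 2 / (3 + a)]) := by
  obtain ⟨ha0, ha1⟩ := ha
  obtain ⟨hx_nonneg, hx_sum⟩ := hx
  obtain ⟨hy_nonneg, hy_sum⟩ := hy
  have hx0 := hx_nonneg 0
  have hx1 := hx_nonneg 1
  have hy0 := hy_nonneg 0
  have hy1 := hy_nonneg 1
  rw [Fin.sum_univ_two] at hx_sum hy_sum
  obtain ⟨p, hp⟩ : ∃ p, p = x 0 := ⟨_, rfl⟩
  obtain ⟨q, hq⟩ : ∃ q, q = y 0 := ⟨_, rfl⟩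
  have hxp : x 1 = 1 - p := by linarith
  have hyq : y 1 = 1 - q := by linarith
  have ha3 : 3 + a ≠ 0 := by linarith
  rw [hxp] at hx1
  rw [hyq] at hy1
  rw [← hp] at hx0
  rw [← hq] at hy0
  constructor
  · rintro ⟨hA, hB⟩
    have row0 := hA _ (single_mem_stdSimplex ℝ 0)
    have row1 := hA _ (single_mem_stdSimplex ℝ 1)
    have col0 := hB _ (single_mem_stdSimplex ℝ 0)
    have col1 := hB _ (single_mem_stdSimplex ℝ 1)
    simp [dotProduct, mulVec, Fin.sum_univ_two, ← hp, ← hq, hxp, hyq] at row0 row1 col0 col1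
    have row0' : (1 - p) * ((3 + a) * q - (1 + a)) ≤ 0 := by linarith
    have row1' : 0 ≤ p * ((3 + a) * q - (1 + a)) := by linarith
    have col0' : (1 - 2 * p) * (1 - q) ≤ 0 := by linarith
    have col1' : 0 ≤ (1 - 2 * p) * q := by linarith
    have hp_half : p = 1 / 2 := by
      rcases lt_trichotomy p (1 / 2) with h | h | h
      · have hq1 : q = 1 := by nlinarith
        subst hq1
        nlinarith
      · exact h
      · have hq0 : q = 0 := by nlinarith
        subst hq0
        nlinarith
    subst hp_half
    have hq_eq : (3 + a) * q = 1 + a := by linarith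
    have hq_div : q = (1 + a) / (3 + a) := by
      rw [eq_div_iff ha3]
      linarith
    refine ⟨?_, ?_⟩
    · ext i
      fin_cases i
      · simp [← hp]
      · norm_num [hxp]
    · ext i
      fin_cases i
      · simp [← hq, hq_div]
      · simp only [Fin.mk_one, hyq, hq_div, cons_val_one, cons_val_fin_one]
        field_simp
        ring
  · rintro ⟨rfl, rfl⟩
    refine ⟨fun w hw => le_of_eq ?_, fun z _ => le_of_eq ?_⟩
    · have hw_sum := hw.2
      rw [Fin.sum_univ_two] at hw_sum
      have hw1 : w 1 = 1 - w 0 := by linarith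
      simp [dotProduct, mulVec, Fin.sum_univ_two, hw1]
      field_simp
      ring
    · simp [dotProduct, mulVec, Fin.sum_univ_two]
      ring
end
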